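/- arXiv:2310.19314 — 2 statements merged into one kernel-verified Lean document; each statement's English description precedes it below -/
import Mathlib

section
/- Let G = (S, T, π) be a two-person win-lose game (S and T of arbitrary cardinality). Then G is totally minimax if and only if G is LNG-free. -/
open scoped ENNReal Classical

/-- The expected payoff to player 1 (probability that player 1 wins) when player 1
uses mixed strategy `p` and player 2 uses mixed strategy `q`. -/
noncomputable def mixedPayoff {S T : Type*} (π : S → T → Prop) (p : PMF S) (q : PMF T) : ℝ≥0∞ :=
  ∑' s, ∑' t, p s * q t * (if π s t then 1 else 0)

/-- The minimax property: `sup_p inf_q π^mix(p,q) = inf_q sup_p π^mix(p,q)`. -/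
def Minimax {S T : Type*} (π : S → T → Prop) : Prop :=
  (⨆ p : PMF S, ⨅ q : PMF T, mixedPayoff π p q)
    = ⨅ q : PMF T, ⨆ p : PMF S, mixedPayoff π p q

/-- A game is totally minimax if every subgame of it (restriction of both strategy
sets to nonempty subsets) satisfies the minimax property. -/
def TotallyMinimax {S T : Type*} (π : S → T → Prop) : Prop :=
  ∀ (S' : Set S) (T' : Set T), S'.Nonempty → T'.Nonempty →
    Minimax fun (s : S') (t : T') => π s t

/-- A game is LNG-free if no subgame of it is isomorphic to the larger number game. -/
def LNGFree {S T : Type*} (π : S → T → Prop) : Prop :=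
  ¬ ∃ (s : ℕ → S) (t : ℕ → T), Function.Injective s ∧ Function.Injective t ∧
      ∀ i j, π (s i) (t j) ↔ j ≤ i

open Filter Set

/-- The expectation of `f` under the weights `w`. -/
noncomputable abbrev expect {X : Type*} (w : X →₀ ℝ) (f : X → ℝ) : ℝ :=
  Finsupp.linearCombination ℝ f w

/-- The finitely supported probability weights on `X`. -/
def finSimplex (X : Type*) : Set (X →₀ ℝ) :=
  {w | (∀ x, 0 ≤ w x) ∧ expect w (fun _ => 1) = 1}

lemma expect_eq_sum {X : Type*} (w : X →₀ ℝ) (f : X → ℝ) :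
    expect w f = ∑ x ∈ w.support, w x * f x := rfl

lemma expect_congr {X : Type*} {w : X →₀ ℝ} {f g : X → ℝ} (h : ∀ x ∈ w.support, f x = g x) :
    expect w f = expect w g := by
  rw [expect_eq_sum, expect_eq_sum]
  exact Finset.sum_congr rfl fun x hx => by rw [h x hx]

lemma expect_mono {X : Type*} {w : X →₀ ℝ} (hw : w ∈ finSimplex X) {f g : X → ℝ}
    (h : ∀ x ∈ w.support, f x ≤ g x) : expect w f ≤ expect w g := by
  rw [expect_eq_sum, expect_eq_sum]
  exact Finset.sum_le_sum fun x hx => mul_le_mul_of_nonneg_left (h x hx) (hw.1 x)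

lemma expect_const {X : Type*} {w : X →₀ ℝ} (hw : w ∈ finSimplex X) (c : ℝ) :
    expect w (fun _ => c) = c := by
  have := hw.2
  rw [expect_eq_sum] at this ⊢
  rw [← Finset.sum_mul]
  simp only [mul_one] at this
  rw [this, one_mul]

lemma expect_add {X : Type*} (w : X →₀ ℝ) (f g : X → ℝ) :
    expect w (fun x => f x + g x) = expect w f + expect w g := by
  simp only [expect_eq_sum, mul_add, Finset.sum_add_distrib]

lemma expect_comm {X Y : Type*} (w : X →₀ ℝ) (u : Y →₀ ℝ) (f : X → Y → ℝ) :
    expect w (fun x => expect u (f x)) = expect u (fun y => expect w fun x => f x y) := by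
  simp only [expect_eq_sum, Finset.mul_sum]
  rw [Finset.sum_comm]
  exact Finset.sum_congr rfl fun y _ => Finset.sum_congr rfl fun x _ => by ring

lemma convex_finSimplex (X : Type*) : Convex ℝ (finSimplex X) := by
  intro v hv w hw α β hα hβ hαβ
  refine ⟨fun x => ?_, ?_⟩
  · have := hv.1 x
    have := hw.1 x
    simp only [Finsupp.coe_add, Finsupp.coe_smul, Pi.add_apply, Pi.smul_apply, smul_eq_mul]
    positivity
  · rw [expect, map_add, map_smul, map_smul, ← expect, ← expect, hv.2, hw.2]
    simpa using hαβ

lemma single_mem_finSimplex {X : Type*} (x : X) : Finsupp.single x (1 : ℝ) ∈ finSimplex X := by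
  refine ⟨fun y => ?_, by simp⟩
  rw [Finsupp.single_apply]
  split_ifs <;> norm_num

/-- One half of the minimax theorem when one of the players is restricted to finitely many
strategies. -/
lemma exists_mem_finSimplex_forall_lt {S T : Type*} [Nonempty T] (F : Finset S)
    (f : S → T → ℝ) (a : ℝ) (h : ∀ w ∈ finSimplex S, ∃ t, expect w (fun s => f s t) < a) :
    ∃ u ∈ finSimplex T, ∀ s ∈ F, expect u (f s) < a := by
  by_contra! hcon
  let L : (T →₀ ℝ) →ₗ[ℝ] (F → ℝ) := Finsupp.linearCombination ℝ (fun t (s : F) => f s t)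
  have hL : ∀ u s, L u s = expect u (f s) := by
    intro u s
    simp only [L, Finsupp.linearCombination_apply, Finsupp.sum, Finset.sum_apply, Pi.smul_apply, smul_eq_mul]
  have hopen : IsOpen {x : F → ℝ | ∀ i, x i < a} := by
    simp only [ofPred_forall]
    exact isOpen_iInter_of_finite fun i => isOpen_lt (continuous_apply i) continuous_const
  have hconv : Convex ℝ {x : F → ℝ | ∀ i, x i < a} := by
    simp only [ofPred_forall]
    exact convex_iInter fun i => convex_halfSpace_lt (LinearMap.proj (R := ℝ) (φ := fun _ : F => ℝ) i).isLinear a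
  have hdisj : Disjoint {x : F → ℝ | ∀ i, x i < a} (L '' finSimplex T) := by
    rw [Set.disjoint_left]
    rintro _ hx ⟨u, hu, rfl⟩
    obtain ⟨s, hs, hle⟩ := hcon u hu
    exact absurd (hx ⟨s, hs⟩) (by rw [hL]; exact not_lt.2 hle)
  obtain ⟨g, c, hg1, hg2⟩ := geometric_hahn_banach_open hconv hopen
    ((convex_finSimplex T).linear_image L) hdisj
  set w : F → ℝ := fun i => g (Pi.single i 1)
  have hgw : ∀ x, g x = ∑ i, x i * w i := by
    intro x
    have := LinearMap.pi_apply_eq_sum_univ (g : (F → ℝ) →ₗ[ℝ] ℝ) x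
    simp only [smul_eq_mul, ContinuousLinearMap.coe_coe] at this
    rw [this]
    refine Finset.sum_congr rfl fun i _ => ?_
    congr 2
    ext j
    simp [Pi.single_apply, eq_comm]
  have hft : ∀ t, c ≤ ∑ i : F, f i t * w i := by
    intro t
    have := hg2 _ ⟨_, single_mem_finSimplex t, rfl⟩
    rw [hgw] at this
    simpa [L] using this
  have hw0 : ∀ i, 0 ≤ w i := by
    intro i
    by_contra! hi
    have key : ∀ r : ℝ, 0 ≤ r → (a - 1) * (∑ j, w j) - r * w i < c := by
      intro r hr
      have := hg1 (fun j => (a - 1) - r * (Pi.single i 1 : F → ℝ) j) (by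
        intro j
        have : 0 ≤ (Pi.single i 1 : F → ℝ) j := by
          rw [Pi.single_apply]; split_ifs <;> norm_num
        nlinarith)
      rw [hgw] at this
      simpa [sub_mul, Finset.sum_sub_distrib, ← Finset.mul_sum, Pi.single_apply, mul_assoc]
        using this
    have h1 := key ((|c| + |(a - 1) * ∑ j, w j|) / (-w i))
      (div_nonneg (by positivity) (by linarith))
    have h2 : (|c| + |(a - 1) * ∑ j, w j|) / (-w i) * w i
        = -(|c| + |(a - 1) * ∑ j, w j|) := by
      rw [div_mul_eq_mul_div, div_neg, mul_div_cancel_right₀ _ hi.ne]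
    rw [h2] at h1
    linarith [le_abs_self c, neg_abs_le ((a - 1) * ∑ j, w j)]
  have hac : a * ∑ i, w i ≤ c := by
    refine le_of_forall_pos_lt_add fun ε hε => ?_
    have hW : 0 ≤ ∑ i, w i := Finset.sum_nonneg fun i _ => hw0 i
    set δ := ε / (∑ i, w i + 1)
    have hδ : 0 < δ := by positivity
    have hδε : δ * (∑ i, w i) < ε := by
      have : δ * (∑ i, w i + 1) = ε := div_mul_cancel₀ _ (by positivity)
      linarith
    have := hg1 (fun _ => a - δ) (fun _ => by linarith)
    rw [hgw, ← Finset.mul_sum] at this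
    linarith
  have hWpos : 0 < ∑ i, w i := by
    refine lt_of_le_of_ne (Finset.sum_nonneg fun i _ => hw0 i) fun h0 => ?_
    have hz : ∀ i, w i = 0 := fun i =>
      (Finset.sum_eq_zero_iff_of_nonneg fun i _ => hw0 i).1 h0.symm i (Finset.mem_univ i)
    have h1 := hg1 (fun _ => a - 1) (fun _ => by linarith)
    have h2 := hft (Classical.arbitrary T)
    rw [hgw] at h1
    simp only [hz, mul_zero, Finset.sum_const_zero] at h1 h2
    linarith
  set W := ∑ i, w i
  let v : S →₀ ℝ := ∑ i : F, Finsupp.single i.1 (w i / W)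
  have hv : ∀ k : S → ℝ, expect v k = (∑ i : F, k i * w i) / W := by
    intro k
    simp only [expect, v, map_sum, Finsupp.linearCombination_single, smul_eq_mul, Finset.sum_div]
    exact Finset.sum_congr rfl fun i _ => by ring
  have hvΔ : v ∈ finSimplex S := by
    refine ⟨fun x => ?_, ?_⟩
    · simp only [v, Finsupp.finsetSum_apply]
      refine Finset.sum_nonneg fun i _ => ?_
      rw [Finsupp.single_apply]
      have := hw0 i
      split_ifs <;> positivity
    · have := hv (fun _ => 1)
      simp only [one_mul] at this
      rw [this]
      exact div_self hWpos.ne'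
  obtain ⟨t, ht⟩ := h v hvΔ
  rw [hv, div_lt_iff₀ hWpos] at ht
  linarith [hft t]

/-- The probability of `E` under the weights `w`. -/
noncomputable def mass {X : Type*} (w : X →₀ ℝ) (E : Set X) : ℝ :=
  expect w (E.indicator 1)

lemma mass_union_add_inter {X : Type*} (w : X →₀ ℝ) (A B : Set X) :
    mass w (A ∪ B) + mass w (A ∩ B) = mass w A + mass w B := by
  simp only [mass]
  rw [← expect_add, ← expect_add]
  exact expect_congr fun x _ => congrFun (indicator_union_add_inter (1 : X → ℝ) A B) x

lemma mass_mono {X : Type*} {w : X →₀ ℝ} (hw : w ∈ finSimplex X) {A B : Set X} (h : A ⊆ B) :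
    mass w A ≤ mass w B :=
  expect_mono hw fun x _ => indicator_le_indicator_of_subset h (fun _ => zero_le_one) x

lemma mass_nonneg {X : Type*} {w : X →₀ ℝ} (hw : w ∈ finSimplex X) (A : Set X) :
    0 ≤ mass w A := by
  rw [← expect_const hw 0]
  exact expect_mono hw fun x _ => indicator_nonneg (fun _ _ => zero_le_one) x

lemma mass_le_one {X : Type*} {w : X →₀ ℝ} (hw : w ∈ finSimplex X) (A : Set X) :
    mass w A ≤ 1 := by
  rw [← expect_const hw 1]
  exact expect_mono hw fun x _ => indicator_le_self' (fun _ _ => zero_le_one) x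

lemma mass_empty {X : Type*} (w : X →₀ ℝ) : mass w ∅ = 0 := by
  simp [mass, expect_eq_sum]

/-- Along the ultrafilter `W`, the trace on `E` of the sets `A i` has asymptotic mass bounded
below. -/
def UniformlyLarge {I J X : Type*} (W : Ultrafilter I) (U : Ultrafilter J) (q : J → X →₀ ℝ)
    (A : I → Set X) (E : Set X) : Prop :=
  ∃ c > 0, ∀ᶠ i in W, ∀ᶠ j in U, c ≤ mass (q j) (E ∩ A i)

lemma UniformlyLarge.nonempty {I J X : Type*} {W : Ultrafilter I} {U : Ultrafilter J}
    {q : J → X →₀ ℝ} {A : I → Set X} {E : Set X} (h : UniformlyLarge W U q A E) :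
    E.Nonempty := by
  obtain ⟨c, hc, h⟩ := h
  obtain ⟨i, hi⟩ := h.exists
  obtain ⟨j, hj⟩ := hi.exists
  rw [nonempty_iff_ne_empty]
  rintro rfl
  rw [empty_inter, mass_empty] at hj
  linarith

lemma UniformlyLarge.eventually_inter {I J X : Type*} {W : Ultrafilter I} {U : Ultrafilter J}
    {q : J → X →₀ ℝ} (hq : ∀ j, q j ∈ finSimplex X) {A : I → Set X} {E : Set X}
    (h : UniformlyLarge W U q A E) : ∀ᶠ i in W, UniformlyLarge W U q A (E ∩ A i) := by
  obtain ⟨c, hc, h⟩ := h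
  obtain ⟨N, hN⟩ := exists_nat_gt (2 / c)
  have hN0 : (0 : ℝ) < N := lt_trans (by positivity) hN
  set d := c / (2 * N)
  have hd : 0 < d := by positivity
  have hNd : N * d = c / 2 := by simp only [d]; field_simp
  by_contra hcon
  have hsmall : ∀ᶠ i in W, ∀ᶠ i' in W, ∀ᶠ j in U, mass (q j) (E ∩ A i ∩ A i') < d := by
    filter_upwards [Ultrafilter.eventually_not.2 hcon] with i hi
    have h1 : ¬ ∀ᶠ i' in W, ∀ᶠ j in U, d ≤ mass (q j) (E ∩ A i ∩ A i') :=
      fun h' => hi ⟨d, hd, h'⟩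
    filter_upwards [Ultrafilter.eventually_not.2 h1] with i' hi'
    filter_upwards [Ultrafilter.eventually_not.2 hi'] with j hj
    exact not_le.1 hj
  have key : ∀ k : ℕ, k ≤ N → ∃ D : Set X, (∀ᶠ j in U, k * (c / 2) ≤ mass (q j) D) ∧
      ∀ᶠ i in W, ∀ᶠ j in U, mass (q j) (D ∩ (E ∩ A i)) ≤ k * d := by
    intro k
    induction k with
    | zero => exact fun _ => ⟨∅, by simp [mass_empty], by simp [mass_empty]⟩
    | succ k ih =>
      intro hk
      obtain ⟨D, hD1, hD2⟩ := ih (by omega)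
      obtain ⟨i, h1, h2, h3⟩ := (h.and (hD2.and hsmall)).exists
      refine ⟨D ∪ (E ∩ A i), ?_, ?_⟩
      · filter_upwards [hD1, h1, h2] with j hj1 hj2 hj3
        have hkN : (k : ℝ) * d ≤ N * d :=
          mul_le_mul_of_nonneg_right (by exact_mod_cast (by omega : k ≤ N)) hd.le
        have := mass_union_add_inter (q j) D (E ∩ A i)
        push_cast
        linarith
      · filter_upwards [hD2, h3] with i' hi1 hi2
        filter_upwards [hi1, hi2] with j hj1 hj2
        have h4 := mass_union_add_inter (q j) (D ∩ (E ∩ A i')) (E ∩ A i ∩ A i')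
        have h5 := mass_nonneg (hq j) (D ∩ (E ∩ A i') ∩ (E ∩ A i ∩ A i'))
        have h6 : (D ∪ E ∩ A i) ∩ (E ∩ A i') ⊆ D ∩ (E ∩ A i') ∪ E ∩ A i ∩ A i' := by
          rintro x ⟨hx | hx, hx'⟩
          · exact Or.inl ⟨hx, hx'⟩
          · exact Or.inr ⟨hx, hx'.2⟩
        have h7 := mass_mono (hq j) h6
        push_cast
        linarith
  obtain ⟨D, hD, -⟩ := key N le_rfl
  obtain ⟨j, hj⟩ := hD.exists
  have h1 := mass_le_one (hq j) D
  rw [div_lt_iff₀ hc] at hN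
  linarith

lemma exists_seq_of_step {α : Type*} {R : α → α → Prop} (P : α → Prop) (x₀ : α) (h₀ : P x₀)
    (h : ∀ x, P x → ∃ y, P y ∧ R x y) :
    ∃ f : ℕ → α, (∀ n, P (f n)) ∧ ∀ n, R (f n) (f (n + 1)) := by
  choose! g hgP hgR using h
  have hP : ∀ n, P (g^[n] x₀) := by
    intro n
    induction n with
    | zero => exact h₀
    | succ n ih => rw [Function.iterate_succ_apply']; exact hgP _ ih
  refine ⟨fun n => g^[n] x₀, hP, fun n => ?_⟩
  simp only [Function.iterate_succ_apply']
  exact hgR _ (hP n)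

/-- A sequence of sets of asymptotic mass bounded below has a subsequence that belongs to a
common ultrafilter. -/
lemma exists_ultrafilter_forall_mem {X : Type*} (q : ℕ → X →₀ ℝ) (hq : ∀ n, q n ∈ finSimplex X)
    (A : ℕ → Set X) {c : ℝ} (hc : 0 < c) (h : ∀ n, ∀ᶠ m in atTop, c ≤ mass (q m) (A n)) :
    ∃ (V : Ultrafilter X) (φ : ℕ → ℕ), StrictMono φ ∧ ∀ k, A (φ k) ∈ V := by
  let W : Ultrafilter ℕ := hyperfilter ℕ
  have hW : (W : Filter ℕ) ≤ atTop := Nat.hyperfilter_le_atTop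
  obtain ⟨f, hf, hR⟩ := exists_seq_of_step
    (R := fun x y : Set X × ℕ => x.2 < y.2 ∧ y.1 ⊆ x.1 ∧ y.1 ⊆ A y.2)
    (fun x => UniformlyLarge W W q A x.1) (univ, 0)
    ⟨c, hc, Eventually.of_forall fun n => by
      simpa only [univ_inter] using (h n).filter_mono hW⟩ (by
    rintro ⟨E, n⟩ hE
    obtain ⟨i, hi1, hi2⟩ := ((UniformlyLarge.eventually_inter hq hE).and
      ((eventually_gt_atTop n).filter_mono hW)).exists
    exact ⟨(E ∩ A i, i), hi1, hi2, inter_subset_left, inter_subset_right⟩)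
  have hanti : Antitone fun k => (f k).1 := antitone_nat_of_succ_le fun k => (hR k).2.1
  have : NeBot (⨅ k, 𝓟 (f k).1) := iInf_neBot_of_directed'
    (Antitone.directed_ge fun _ _ h => principal_mono.2 (hanti h))
    fun k => principal_neBot_iff.2 (hf k).nonempty
  refine ⟨Ultrafilter.of (⨅ k, 𝓟 (f k).1), fun k => (f (k + 1)).2,
    strictMono_nat_of_lt_succ fun k => (hR (k + 1)).1, fun k => ?_⟩
  refine Ultrafilter.of_le _ (mem_of_superset ?_ (hR k).2.2)
  exact mem_iInf_of_mem (k + 1) (mem_principal_self _)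

/-- If the `t`-sections intersected with the strategies losing along `V` have asymptotic mass
bounded below along `V`, then the game contains the larger number game. -/
lemma not_LNGFree_of_uniformlyLarge {J S T : Type*} {π : S → T → Prop} {V : Ultrafilter T}
    {U : Ultrafilter J} {p : J → S →₀ ℝ} (hp : ∀ j, p j ∈ finSimplex S)
    (h : UniformlyLarge V U p (fun t => {s | π s t}) {s | ∀ᶠ t in V, ¬ π s t}) :
    ¬ LNGFree π := by
  let A : T → Set S := fun t => {s | π s t}
  obtain ⟨s₀, -⟩ := h.nonempty
  obtain ⟨t₀, -⟩ := (univ_mem : univ ∈ V) |> V.nonempty_of_mem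
  obtain ⟨f, hf, hR⟩ := exists_seq_of_step
    (R := fun x y : (Set S × Set T) × S × T => y.1.1 ⊆ x.1.1 ∧ y.1.2 ⊆ x.1.2 ∧
      y.2.1 ∈ y.1.1 ∧ y.1.1 ⊆ A y.2.2 ∧ y.2.2 ∈ x.1.2 ∧ y.1.2 ⊆ {t | ¬ π y.2.1 t})
    (fun x => UniformlyLarge V U p A x.1.1 ∧ x.1.1 ⊆ {s | ∀ᶠ t in V, ¬ π s t} ∧ x.1.2 ∈ V)
    (({s | ∀ᶠ t in V, ¬ π s t}, univ), s₀, t₀) ⟨h, subset_rfl, univ_mem⟩ (by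
    rintro ⟨⟨E, D⟩, _, _⟩ ⟨hE, hsub, hD⟩
    obtain ⟨t, ht1, ht2⟩ := ((UniformlyLarge.eventually_inter hp hE).and hD).exists
    obtain ⟨s, hs⟩ := ht1.nonempty
    exact ⟨((E ∩ A t, D ∩ {t | ¬ π s t}), s, t),
      ⟨ht1, inter_subset_left.trans hsub, inter_mem hD (hsub hs.1)⟩,
      inter_subset_left, inter_subset_left, hs, inter_subset_right, ht2, inter_subset_right⟩)
  have hE : Antitone fun k => (f k).1.1 := antitone_nat_of_succ_le fun k => (hR k).1
  have hD : Antitone fun k => (f k).1.2 := antitone_nat_of_succ_le fun k => (hR k).2.1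
  have hwin : ∀ i j, j ≤ i → π (f (i + 1)).2.1 (f (j + 1)).2.2 := fun i j hij =>
    (hR j).2.2.2.1 (hE (Nat.succ_le_succ hij) (hR i).2.2.1)
  have hlose : ∀ i j, i < j → ¬ π (f (i + 1)).2.1 (f (j + 1)).2.2 := fun i j hij =>
    (hR i).2.2.2.2.2 (hD (Nat.succ_le_of_lt hij) (hR j).2.2.2.2.1)
  refine not_not.2 ⟨fun i => (f (i + 1)).2.1, fun j => (f (j + 1)).2.2, ?_, ?_, fun i j =>
    ⟨fun hπ => not_lt.1 fun hij => hlose i j hij hπ, hwin i j⟩⟩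
  · refine Function.Injective.of_lt_imp_ne fun i i' hii' heq => hlose i i' hii' ?_
    rw [heq]
    exact hwin i' i' le_rfl
  · refine Function.Injective.of_lt_imp_ne fun j j' hjj' heq => hlose j j' hjj' ?_
    rw [← heq]
    exact hwin j j le_rfl

lemma mass_ofPred {X : Type*} (w : X →₀ ℝ) (P : X → Prop) :
    mass w {x | P x} = expect w (fun x => if P x then 1 else 0) :=
  expect_congr fun x _ => by simp [indicator_apply]

lemma expect_neg {X : Type*} (w : X →₀ ℝ) (f : X → ℝ) :
    expect w (fun x => -f x) = -expect w f := by
  simp only [expect_eq_sum, mul_neg, Finset.sum_neg_distrib]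

lemma expect_mass_comm {S T : Type*} (π : S → T → Prop) (p : S →₀ ℝ) (q : T →₀ ℝ) :
    expect q (fun t => mass p {s | π s t}) = expect p (fun s => mass q {t | π s t}) := by
  simp only [mass_ofPred]
  exact expect_comm q p fun t s => if π s t then 1 else 0

/-- A gap between the two values of a game yields sequences of mixed strategies, supported in
sets against which the later opposing strategies all perform well. -/
lemma exists_seq_of_gap {S T : Type*} [Nonempty S] [Nonempty T] {π : S → T → Prop} {a b : ℝ}
    (h1 : ∀ w ∈ finSimplex S, ∃ t, mass w {s | π s t} < a)
    (h2 : ∀ u ∈ finSimplex T, ∃ s, b < mass u {t | π s t}) :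
    ∃ (p : ℕ → S →₀ ℝ) (q : ℕ → T →₀ ℝ), (∀ n, p n ∈ finSimplex S) ∧ (∀ n, q n ∈ finSimplex T) ∧
      (∀ n m, n < m → ∀ s ∈ (p n).support, mass (q m) {t | π s t} < a) ∧
      ∀ n m, n < m → ∀ t ∈ (q n).support, b < mass (p m) {s | π s t} := by
  have hQ : ∀ F : Finset S, ∃ u ∈ finSimplex T, ∀ s ∈ F, mass u {t | π s t} < a := by
    intro F
    simp only [mass_ofPred] at h1 ⊢
    exact exists_mem_finSimplex_forall_lt F (fun s t => if π s t then 1 else 0) a h1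
  have hP : ∀ H : Finset T, ∃ w ∈ finSimplex S, ∀ t ∈ H, b < mass w {s | π s t} := by
    intro H
    simp only [mass_ofPred] at h2 ⊢
    obtain ⟨w, hw, h⟩ := exists_mem_finSimplex_forall_lt H
      (fun t s => -(if π s t then 1 else 0)) (-b) fun u hu => by
        obtain ⟨s, hs⟩ := h2 u hu
        exact ⟨s, by rw [expect_neg]; linarith⟩
    refine ⟨w, hw, fun t ht => ?_⟩
    have := h t ht
    rw [expect_neg] at this
    linarith
  choose Q hQΔ hQ using hQ
  choose P hPΔ hP using hP
  let st : ℕ → Finset S × Finset T := fun n =>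
    Nat.rec (∅, ∅) (fun _ x => (x.1 ∪ (P x.2).support, x.2 ∪ (Q x.1).support)) n
  have hF : Monotone fun n => (st n).1 :=
    monotone_nat_of_le_succ fun n => Finset.subset_union_left
  have hH : Monotone fun n => (st n).2 :=
    monotone_nat_of_le_succ fun n => Finset.subset_union_left
  have hFs : ∀ n, (P (st n).2).support ⊆ (st (n + 1)).1 := fun n => Finset.subset_union_right
  have hHs : ∀ n, (Q (st n).1).support ⊆ (st (n + 1)).2 := fun n => Finset.subset_union_right
  exact ⟨fun n => P (st n).2, fun n => Q (st n).1, fun n => hPΔ _, fun n => hQΔ _,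
    fun n m hnm s hs => hQ _ s (hF hnm (hFs n hs)),
    fun n m hnm t ht => hP _ t (hH hnm (hHs n ht))⟩

lemma not_LNGFree_of_gap {S T : Type*} [Nonempty S] [Nonempty T] {π : S → T → Prop} {a b : ℝ}
    (hab : a < b) (h1 : ∀ w ∈ finSimplex S, ∃ t, mass w {s | π s t} < a)
    (h2 : ∀ u ∈ finSimplex T, ∃ s, b < mass u {t | π s t}) : ¬ LNGFree π := by
  obtain ⟨p, q, hp, hq, hpq, hqp⟩ := exists_seq_of_gap h1 h2
  have hb1 : b < 1 := by
    obtain ⟨s, hs⟩ := h2 _ (hq 0)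
    exact hs.trans_le (mass_le_one (hq 0) _)
  obtain ⟨a', haa', ha'b⟩ := exists_between hab
  let A : ℕ → Set T := fun n => {t | (∃ k, t ∈ (q k).support) ∧ mass (p n) {s | π s t} ≤ a'}
  have hA : ∀ n, ∀ᶠ m in atTop, a' - a ≤ mass (q m) (A n) := by
    intro n
    filter_upwards [eventually_gt_atTop n] with m hm
    have hle : expect (q m) (fun t => mass (p n) {s | π s t}) ≤ a := by
      rw [expect_mass_comm, ← expect_const (hp n) a]
      exact expect_mono (hp n) fun s hs => (hpq n m hm s hs).le
    have hge : a' ≤ expect (q m) (fun t => mass (p n) {s | π s t} + (A n).indicator 1 t) := by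
      rw [← expect_const (hq m) a']
      refine expect_mono (hq m) fun t ht => ?_
      by_cases hta : mass (p n) {s | π s t} ≤ a'
      · have : t ∈ A n := ⟨⟨m, ht⟩, hta⟩
        have h0 := mass_nonneg (hp n) {s | π s t}
        simp only [indicator_of_mem this, Pi.one_apply]
        linarith
      · have h0 : 0 ≤ (A n).indicator (1 : T → ℝ) t := indicator_nonneg (fun _ _ => zero_le_one) t
        linarith
    rw [expect_add] at hge
    change _ ≤ _ + mass (q m) (A n) at hge
    linarith
  obtain ⟨V, φ, hφ, hV⟩ := exists_ultrafilter_forall_mem q hq A (sub_pos.2 haa') hA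
  have hlim : ∀ k, mass (p (φ k)) {s | ∀ᶠ t in V, π s t} ≤ a' := by
    intro k
    have hev : ∀ᶠ t in V, ∀ s ∈ (p (φ k)).support, (∀ᶠ t in V, π s t) → π s t := by
      rw [eventually_all_finset]
      intro s _
      by_cases hs : ∀ᶠ t in V, π s t
      · filter_upwards [hs] with t ht _ using ht
      · exact Eventually.of_forall fun t h => absurd h hs
    obtain ⟨t, ht, -, htA⟩ := (hev.and (hV k)).exists
    refine le_trans ?_ htA
    rw [mass_ofPred, mass_ofPred]
    refine expect_mono (hp _) fun s hs => ?_
    by_cases h : ∀ᶠ t in V, π s t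
    · rw [if_pos h, if_pos (ht s hs h)]
    · rw [if_neg h]; split_ifs <;> norm_num
  refine not_LNGFree_of_uniformlyLarge (V := V) (U := hyperfilter ℕ) (p := fun k => p (φ k))
    (fun k => hp _) ⟨b - a', sub_pos.2 ha'b, ?_⟩
  filter_upwards [hV 0] with t ht
  obtain ⟨⟨n, hn⟩, -⟩ := ht
  refine Eventually.filter_mono Nat.hyperfilter_le_atTop ?_
  filter_upwards [eventually_gt_atTop n] with k hk
  have h3 := hqp n (φ k) (hk.trans_le hφ.le_apply) t hn
  have h4 := hlim k
  have h5 := mass_union_add_inter (p (φ k)) {s | ∀ᶠ t in V, π s t}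
    ({s | ∀ᶠ t in V, ¬ π s t} ∩ {s | π s t})
  have h6 := mass_mono (hp (φ k)) (A := {s | π s t})
    (B := {s | ∀ᶠ t in V, π s t} ∪ {s | ∀ᶠ t in V, ¬ π s t} ∩ {s | π s t}) fun s hs =>
      (em (∀ᶠ t in V, π s t)).imp id fun h => ⟨Ultrafilter.eventually_not.2 h, hs⟩
  have h7 := mass_nonneg (hp (φ k)) ({s | ∀ᶠ t in V, π s t} ∩
    ({s | ∀ᶠ t in V, ¬ π s t} ∩ {s | π s t}))
  linarith

/-- Finitely supported weights as a probability mass function. -/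
noncomputable def finSimplexPMF {X : Type*} (w : X →₀ ℝ) (hw : w ∈ finSimplex X) : PMF X :=
  PMF.ofFinset (fun x => ENNReal.ofReal (w x)) w.support
    (by
      have := hw.2
      rw [expect_eq_sum] at this
      simp only [mul_one] at this
      rw [← ENNReal.ofReal_sum_of_nonneg fun x _ => hw.1 x, this, ENNReal.ofReal_one])
    (fun x hx => by rw [Finsupp.notMem_support_iff.1 hx, ENNReal.ofReal_zero])

lemma tsum_finSimplexPMF {X : Type*} {w : X →₀ ℝ} (hw : w ∈ finSimplex X) (P : X → Prop) :
    ∑' x, finSimplexPMF w hw x * (if P x then 1 else 0) = ENNReal.ofReal (mass w {x | P x}) := by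
  rw [mass_ofPred, expect_eq_sum, ENNReal.ofReal_sum_of_nonneg fun x _ =>
    mul_nonneg (hw.1 x) (by split_ifs <;> norm_num), tsum_eq_sum (s := w.support)]
  · refine Finset.sum_congr rfl fun x _ => ?_
    rw [finSimplexPMF, PMF.ofFinset_apply]
    split_ifs <;> simp
  · intro x hx
    rw [finSimplexPMF, PMF.ofFinset_apply, Finsupp.notMem_support_iff.1 hx]
    simp

lemma mixedPayoff_eq_tsum_left {S T : Type*} (π : S → T → Prop) (p : PMF S) (q : PMF T) :
    mixedPayoff π p q = ∑' s, p s * ∑' t, q t * (if π s t then 1 else 0) := by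
  simp only [mixedPayoff, mul_assoc, ENNReal.tsum_mul_left]

lemma mixedPayoff_eq_tsum_right {S T : Type*} (π : S → T → Prop) (p : PMF S) (q : PMF T) :
    mixedPayoff π p q = ∑' t, q t * ∑' s, p s * (if π s t then 1 else 0) := by
  rw [mixedPayoff, ENNReal.tsum_comm]
  simp only [← ENNReal.tsum_mul_left]
  exact tsum_congr fun t => tsum_congr fun s => by ring

lemma minimax_of_LNGFree {S T : Type*} [Nonempty S] [Nonempty T] {π : S → T → Prop}
    (h : LNGFree π) : Minimax π := by
  refine le_antisymm (iSup_iInf_le_iInf_iSup _) (not_lt.1 fun hlt => ?_)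
  obtain ⟨a, ha, hlt⟩ := ENNReal.lt_iff_exists_nnreal_btwn.1 hlt
  obtain ⟨b, hab, hb⟩ := ENNReal.lt_iff_exists_nnreal_btwn.1 hlt
  refine not_LNGFree_of_gap (a := a) (b := b) (by exact_mod_cast hab) ?_ ?_ h
  · intro w hw
    by_contra! hcon
    obtain ⟨q, hq⟩ := iInf_lt_iff.1
      ((le_iSup (fun p => ⨅ q, mixedPayoff π p q) (finSimplexPMF w hw)).trans_lt ha)
    refine hq.not_ge ?_
    rw [mixedPayoff_eq_tsum_right]
    calc (a : ℝ≥0∞) = ∑' t, q t * a := by rw [ENNReal.tsum_mul_right, q.tsum_coe, one_mul]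
      _ ≤ _ := ENNReal.tsum_le_tsum fun t => by
        rw [tsum_finSimplexPMF]
        gcongr
        exact ENNReal.ofReal_coe_nnreal.symm.trans_le (ENNReal.ofReal_le_ofReal (hcon t))
  · intro u hu
    by_contra! hcon
    obtain ⟨p, hp⟩ := lt_iSup_iff.1
      (hb.trans_le (iInf_le (fun q => ⨆ p, mixedPayoff π p q) (finSimplexPMF u hu)))
    refine hp.not_ge ?_
    rw [mixedPayoff_eq_tsum_left]
    calc _ ≤ ∑' s, p s * b := ENNReal.tsum_le_tsum fun s => by
            rw [tsum_finSimplexPMF]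
            gcongr
            exact (ENNReal.ofReal_le_ofReal (hcon s)).trans_eq ENNReal.ofReal_coe_nnreal
      _ = b := by rw [ENNReal.tsum_mul_right, p.tsum_coe, one_mul]

lemma mixedPayoff_pure_left {S T : Type*} (π : S → T → Prop) (s : S) (q : PMF T) :
    mixedPayoff π (PMF.pure s) q = ∑' t, q t * (if π s t then 1 else 0) := by
  rw [mixedPayoff_eq_tsum_left, tsum_eq_single s fun s' hs' => by simp [hs']]
  simp

lemma mixedPayoff_pure_right {S T : Type*} (π : S → T → Prop) (p : PMF S) (t : T) :
    mixedPayoff π p (PMF.pure t) = ∑' s, p s * (if π s t then 1 else 0) := by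
  rw [mixedPayoff_eq_tsum_right, tsum_eq_single t fun t' ht' => by simp [ht']]
  simp

/-- The larger number game does not satisfy the minimax property. -/
lemma not_minimax_of_equiv {S T : Type*} {π : S → T → Prop} (e : ℕ ≃ S) (d : ℕ ≃ T)
    (h : ∀ i j, π (e i) (d j) ↔ j ≤ i) : ¬ Minimax π := by
  have hlow : (⨆ p : PMF S, ⨅ q : PMF T, mixedPayoff π p q) = 0 := by
    refine bot_unique (iSup_le fun p => ?_)
    have hsum : ∑' i, p (e i) ≠ ∞ := by rw [e.tsum_eq (f := p), p.tsum_coe]; simp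
    refine ge_of_tendsto (ENNReal.tendsto_sum_nat_add _ hsum) (Eventually.of_forall fun j => ?_)
    refine (iInf_le _ (PMF.pure (d j))).trans_eq ?_
    rw [mixedPayoff_pure_right, ← e.tsum_eq, ← (add_left_injective j).tsum_eq]
    · simp [h]
    · intro i hi
      simp only [Function.mem_support, h, ne_eq, mul_eq_zero, not_or, ite_eq_right_iff,
        Classical.not_imp] at hi
      exact ⟨i - j, Nat.sub_add_cancel hi.2.1⟩
  have hhigh : 1 ≤ ⨅ q : PMF T, ⨆ p : PMF S, mixedPayoff π p q := by
    refine le_iInf fun q => ?_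
    rw [← q.tsum_coe, ← d.tsum_eq (f := q), ENNReal.tsum_eq_iSup_nat]
    refine iSup_le fun n => le_trans ?_ (le_iSup _ (PMF.pure (e n)))
    rw [mixedPayoff_pure_left, ← d.tsum_eq]
    refine le_trans (Finset.sum_le_sum fun j hj => ?_) (ENNReal.sum_le_tsum (Finset.range n))
    simp [h, (Finset.mem_range.1 hj).le]
  intro hmin
  rw [Minimax, hlow] at hmin
  rw [← hmin] at hhigh
  simp at hhigh

/-- Theorem 3.1: a game is totally minimax if and only if it is LNG-free. -/
theorem totallyMinimax_iff_LNGFree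
    {S T : Type*} [Nonempty S] [Nonempty T] (π : S → T → Prop) :
    TotallyMinimax π ↔ LNGFree π := by
  constructor
  · rintro h ⟨s, t, hs, ht, hst⟩
    exact not_minimax_of_equiv (Equiv.ofInjective s hs) (Equiv.ofInjective t ht) hst
      (h _ _ (range_nonempty s) (range_nonempty t))
  · rintro h S' T' hS hT
    have := hS.to_subtype
    have := hT.to_subtype
    exact minimax_of_LNGFree fun ⟨s, t, hs, ht, hst⟩ => h ⟨fun i => s i, fun j => t j,
      Subtype.val_injective.comp hs, Subtype.val_injective.comp ht, hst⟩
end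

section
/- Let G = (S, T, π) be a two-person win-lose game and suppose at least one of the following holds: (1) for all but finitely many s ∈ S, the set {t ∈ T : π(s,t) = 0} is finite; (2) there is a finite bound k such that for all but finitely many s ∈ S, |{t ∈ T : π(s,t) = 1}| ≤ k; (3) there is a finite bound k such that for all but finitely many t ∈ T, |{s ∈ S : π(s,t) = 0}| ≤ k; (4) for all but finitely many t ∈ T, the set {s ∈ S : π(s,t) = 1} is finite. Then G is totally minimax. -/
open scoped ENNReal Classical

section PMF

variable {α : Type*}

theorem PMF.toOuterMeasure_union_of_disjoint (p : PMF α) {A B : Set α} (h : Disjoint A B) :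
    p.toOuterMeasure (A ∪ B) = p.toOuterMeasure A + p.toOuterMeasure B := by
  simp only [PMF.toOuterMeasure_apply, ← ENNReal.tsum_add, Set.indicator_union_of_disjoint h]

theorem PMF.toOuterMeasure_univ (p : PMF α) : p.toOuterMeasure Set.univ = 1 := by
  simp [PMF.toOuterMeasure_apply, p.tsum_coe]

/-- The law of a finite family of points with prescribed real weights. -/
theorem PMF.exists_toOuterMeasure_eq_ofReal {ι : Type*} [Fintype ι] (w : ι → ℝ)
    (hw : ∀ i, 0 ≤ w i) (hsum : ∑ i, w i = 1) (g : ι → α) :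
    ∃ p : PMF α, ∀ A : Set α,
      p.toOuterMeasure A = ENNReal.ofReal (∑ i, w i * if g i ∈ A then 1 else 0) := by
  refine ⟨(PMF.ofFintype (fun i => ENNReal.ofReal (w i)) ?_).map g, fun A => ?_⟩
  · rw [← ENNReal.ofReal_sum_of_nonneg fun i _ => hw i, hsum, ENNReal.ofReal_one]
  · rw [PMF.toOuterMeasure_map_apply, PMF.toOuterMeasure_apply_fintype,
      ENNReal.ofReal_sum_of_nonneg fun i _ => mul_nonneg (hw i) (by split_ifs <;> norm_num)]
    refine Finset.sum_congr rfl fun i _ => ?_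
    by_cases hi : g i ∈ A <;> simp [hi]

end PMF

section MixedPayoff

variable {S T : Type*} (π : S → T → Prop)

theorem mixedPayoff_eq_tsum_rows (p : PMF S) (q : PMF T) :
    mixedPayoff π p q = ∑' s, p s * q.toOuterMeasure {t | π s t} := by
  simp only [mixedPayoff, PMF.toOuterMeasure_apply, ← ENNReal.tsum_mul_left]
  refine tsum_congr fun s => tsum_congr fun t => ?_
  by_cases h : π s t <;> simp [h]

theorem mixedPayoff_eq_tsum_columns (p : PMF S) (q : PMF T) :
    mixedPayoff π p q = ∑' t, q t * p.toOuterMeasure {s | π s t} := by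
  rw [mixedPayoff, ENNReal.tsum_comm]
  simp only [PMF.toOuterMeasure_apply, ← ENNReal.tsum_mul_left]
  refine tsum_congr fun t => tsum_congr fun s => ?_
  by_cases h : π s t <;> simp [h, mul_comm]

theorem mixedPayoff_le_of_rows_le {q : PMF T} {v : ℝ≥0∞}
    (h : ∀ s, q.toOuterMeasure {t | π s t} ≤ v) (p : PMF S) : mixedPayoff π p q ≤ v := by
  rw [mixedPayoff_eq_tsum_rows]
  calc ∑' s, p s * q.toOuterMeasure {t | π s t} ≤ ∑' s, p s * v := by gcongr with s; exact h s
    _ = v := by rw [ENNReal.tsum_mul_right, p.tsum_coe, one_mul]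

theorem le_mixedPayoff_of_le_columns {p : PMF S} {v : ℝ≥0∞}
    (h : ∀ t, v ≤ p.toOuterMeasure {s | π s t}) (q : PMF T) : v ≤ mixedPayoff π p q := by
  rw [mixedPayoff_eq_tsum_columns]
  calc v = ∑' t, q t * v := by rw [ENNReal.tsum_mul_right, q.tsum_coe, one_mul]
    _ ≤ ∑' t, q t * p.toOuterMeasure {s | π s t} := by gcongr with t; exact h t

theorem mixedPayoff_le_one (p : PMF S) (q : PMF T) : mixedPayoff π p q ≤ 1 :=
  mixedPayoff_le_of_rows_le π
    (fun _ => (q.toOuterMeasure.mono (Set.subset_univ _)).trans_eq q.toOuterMeasure_univ) p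

theorem mixedPayoff_dual (p : PMF S) (q : PMF T) :
    mixedPayoff (fun t s => ¬ π s t) q p = 1 - mixedPayoff π p q := by
  refine ENNReal.eq_sub_of_add_eq
    (ne_top_of_le_ne_top ENNReal.one_ne_top (mixedPayoff_le_one π p q)) ?_
  rw [mixedPayoff_eq_tsum_rows, mixedPayoff_eq_tsum_columns, ← ENNReal.tsum_add, ← q.tsum_coe]
  refine tsum_congr fun t => ?_
  rw [← mul_add, ← PMF.toOuterMeasure_union_of_disjoint]
  · have : {s | ¬ π s t} ∪ {s | π s t} = Set.univ := by ext s; simp [em']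
    rw [this, PMF.toOuterMeasure_univ, mul_one]
  · exact Set.disjoint_left.2 fun s hs hs' => hs hs'

/-- The value player 1 can guarantee with mixed strategies. -/
noncomputable def lowerValue : ℝ≥0∞ := ⨆ p : PMF S, ⨅ q : PMF T, mixedPayoff π p q

variable {π}

theorem Minimax.of_dual [Nonempty S] [Nonempty T] (h : Minimax fun t s => ¬ π s t) :
    Minimax π := by
  have : Nonempty (PMF S) := ‹Nonempty S›.map PMF.pure
  have : Nonempty (PMF T) := ‹Nonempty T›.map PMF.pure
  simp only [Minimax, mixedPayoff_dual] at h ⊢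
  have hle (p : PMF S) : ⨅ q : PMF T, mixedPayoff π p q ≤ 1 :=
    iInf_le_of_le (Classical.arbitrary _) (mixedPayoff_le_one π _ _)
  have hle' (q : PMF T) : ⨆ p : PMF S, mixedPayoff π p q ≤ 1 :=
    iSup_le fun p => mixedPayoff_le_one π _ _
  simp only [← ENNReal.sub_iSup ENNReal.one_ne_top, ← ENNReal.sub_iInf] at h
  refine ((ENNReal.sub_right_inj ENNReal.one_ne_top ?_ ?_).1 h).symm
  · exact iInf_le_of_le (Classical.arbitrary _) (hle' _)
  · exact iSup_le hle

theorem lowerValue_le_one [Nonempty T] : lowerValue π ≤ 1 := by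
  have : Nonempty (PMF T) := ‹Nonempty T›.map PMF.pure
  exact iSup_le fun p => iInf_le_of_le (Classical.arbitrary _) (mixedPayoff_le_one π _ _)

theorem Minimax.of_forall_exists_le_add
    (h : ∀ ε : ℝ≥0∞, ε ≠ 0 →
      ∃ q : PMF T, ∀ s, q.toOuterMeasure {t | π s t} ≤ lowerValue π + ε) :
    Minimax π := by
  refine le_antisymm (iSup_iInf_le_iInf_iSup _) ?_
  refine ENNReal.le_of_forall_pos_le_add fun ε hε _ => ?_
  obtain ⟨q, hq⟩ := h ε (by simpa using hε.ne')
  exact iInf_le_of_le q (iSup_le fun p => mixedPayoff_le_of_rows_le π hq p)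

/-- Player 2 can hold any finite set of rows to the lower value of the game. -/
theorem exists_pmf_rows_le_lowerValue [Nonempty T] (S₀ : Finset S) :
    ∃ q : PMF T, ∀ s ∈ S₀, q.toOuterMeasure {t | π s t} ≤ lowerValue π := by
  have hV : ENNReal.ofReal (lowerValue π).toReal = lowerValue π :=
    ENNReal.ofReal_toReal (ne_top_of_le_ne_top ENNReal.one_ne_top lowerValue_le_one)
  set V := (lowerValue π).toReal
  let X : T → S₀ → ℝ := fun t s => if π s t then 1 else 0
  have hX : (Set.range X).Finite := by
    let Y : (S₀ → Prop) → S₀ → ℝ := fun b s => if b s then 1 else 0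
    refine (Set.finite_range Y).subset ?_
    rintro _ ⟨t, rfl⟩
    exact ⟨fun s => π s t, rfl⟩
  by_cases hdisj : Disjoint (convexHull ℝ (Set.range X)) (Set.Iic fun _ => V)
  · exfalso
    obtain ⟨f, u, v, hu, huv, hv⟩ := geometric_hahn_banach_compact_closed
      (convex_convexHull ℝ _) (hX.isCompact_convexHull ℝ) (convex_Iic _) isClosed_Iic hdisj
    let e : S₀ → S₀ → ℝ := fun s => Pi.single s 1
    have hf (y : S₀ → ℝ) : f y = ∑ s, y s * f (e s) := by
      have := LinearMap.pi_apply_eq_sum_univ (f : (S₀ → ℝ) →ₗ[ℝ] ℝ) y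
      simp only [ContinuousLinearMap.coe_coe, smul_eq_mul] at this
      rw [this]
      refine Finset.sum_congr rfl fun s _ => ?_
      congr 2
      ext j
      simp [e, Pi.single_apply, eq_comm]
    have hvV : v < f fun _ => V := hv _ (Set.mem_Iic.2 le_rfl)
    have he (s : S₀) : f (e s) ≤ 0 := by
      by_contra! hpos
      have hr : 0 ≤ (f (fun _ => V) - v) / f (e s) := by
        have := sub_pos.2 hvV
        positivity
      have := hv ((fun _ => V) - ((f (fun _ => V) - v) / f (e s)) • e s) (by
        rw [Set.mem_Iic]
        refine sub_le_self _ (smul_nonneg hr ?_)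
        exact Pi.single_nonneg.2 zero_le_one)
      rw [map_sub, map_smul, smul_eq_mul, div_mul_cancel₀ _ hpos.ne'] at this
      linarith
    set A := ∑ s, -f (e s) with hA
    have hA_nonneg : 0 ≤ A := Finset.sum_nonneg fun s _ => neg_nonneg.2 (he s)
    have hVA : f (fun _ => V) = -(V * A) := by
      rw [hf, hA, ← Finset.mul_sum, Finset.sum_neg_distrib, mul_neg, neg_neg]
    have hXu (t : T) : f (X t) < u := hu _ (subset_convexHull ℝ _ ⟨t, rfl⟩)
    have hA_pos : 0 < A := by
      refine hA_nonneg.lt_of_ne' fun h0 => ?_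
      have hz : ∀ s, f (e s) = 0 := fun s => by
        have := (Finset.sum_eq_zero_iff_of_nonneg fun s _ => neg_nonneg.2 (he s)).1 h0 s
          (Finset.mem_univ _)
        linarith
      have := hXu (Classical.arbitrary T)
      rw [hf] at this
      simp only [hz, mul_zero, Finset.sum_const_zero] at this
      rw [hVA, h0] at hvV
      linarith
    obtain ⟨p, hp⟩ := PMF.exists_toOuterMeasure_eq_ofReal (fun s => -f (e s) / A)
      (fun s => div_nonneg (neg_nonneg.2 (he s)) hA_nonneg)
      (by rw [← Finset.sum_div, div_self hA_pos.ne']) (fun s : S₀ => (s : S))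
    have hVu : V < -u / A := by
      rw [lt_div_iff₀ hA_pos]
      linarith
    have hcol (t : T) : ENNReal.ofReal (-u / A) ≤ p.toOuterMeasure {s | π s t} := by
      rw [hp]
      refine ENNReal.ofReal_le_ofReal ?_
      have : ∑ s : S₀, -f (e s) / A * (if (s : S) ∈ {s | π s t} then 1 else 0) = -f (X t) / A := by
        rw [hf, ← Finset.sum_neg_distrib, Finset.sum_div]
        refine Finset.sum_congr rfl fun s _ => ?_
        simp only [X, Set.mem_ofPred_eq]
        ring
      rw [this]
      have := hXu t
      gcongr
    have hle : ENNReal.ofReal (-u / A) ≤ lowerValue π :=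
      le_iSup_of_le p (le_iInf fun q => le_mixedPayoff_of_le_columns π hcol q)
    rw [← hV, ENNReal.ofReal_le_ofReal_iff ENNReal.toReal_nonneg] at hle
    linarith
  · obtain ⟨y, hy, hyV⟩ := Set.not_disjoint_iff.1 hdisj
    obtain ⟨ι, _, w, x, hw, hsum, hx, rfl⟩ := mem_convexHull_iff_exists_fintype.1 hy
    choose g hg using hx
    obtain ⟨q, hq⟩ := PMF.exists_toOuterMeasure_eq_ofReal w hw hsum g
    refine ⟨q, fun s hs => ?_⟩
    rw [hq, ← hV]
    refine ENNReal.ofReal_le_ofReal ?_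
    have := hyV ⟨s, hs⟩
    simpa [← hg, X] using this

end MixedPayoff

/-- A finitely additive probability defined on all sets. -/
structure IsFinitelyAdditiveProb {T : Type*} (μ : Set T → ℝ≥0∞) : Prop where
  univ : μ Set.univ = 1
  union : ∀ A B, Disjoint A B → μ (A ∪ B) = μ A + μ B

namespace IsFinitelyAdditiveProb

variable {S T : Type*} {μ : Set T → ℝ≥0∞}

theorem _root_.PMF.isFinitelyAdditiveProb (p : PMF T) :
    IsFinitelyAdditiveProb fun A => p.toOuterMeasure A :=
  ⟨p.toOuterMeasure_univ, fun _ _ => p.toOuterMeasure_union_of_disjoint⟩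

theorem mono (hμ : IsFinitelyAdditiveProb μ) {A B : Set T} (h : A ⊆ B) : μ A ≤ μ B := by
  rw [← Set.union_sdiff_cancel h, hμ.union _ _ Set.disjoint_sdiff_right]
  exact le_self_add

theorem le_one (hμ : IsFinitelyAdditiveProb μ) (A : Set T) : μ A ≤ 1 :=
  hμ.univ ▸ hμ.mono (Set.subset_univ A)

theorem empty (hμ : IsFinitelyAdditiveProb μ) : μ ∅ = 0 := by
  have h := hμ.union Set.univ ∅ (Set.disjoint_empty _)
  rw [Set.union_empty, hμ.univ] at h
  exact (ENNReal.add_right_inj ENNReal.one_ne_top).1 (by rw [← h, add_zero])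

theorem add_compl (hμ : IsFinitelyAdditiveProb μ) (A : Set T) : μ A + μ Aᶜ = 1 := by
  rw [← hμ.union _ _ disjoint_compl_right, Set.union_compl_self, hμ.univ]

theorem biUnion (hμ : IsFinitelyAdditiveProb μ) {ι : Type*} (s : Finset ι) (A : ι → Set T)
    (h : Pairwise fun i j => Disjoint (A i) (A j)) : μ (⋃ i ∈ s, A i) = ∑ i ∈ s, μ (A i) := by
  induction s using Finset.induction_on with
  | empty => simpa using hμ.empty
  | insert i s hi ih =>
    rw [Finset.set_biUnion_insert, hμ.union, ih, Finset.sum_insert hi]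
    simp only [Set.disjoint_iUnion_right]
    exact fun j hj => h (ne_of_mem_of_not_mem hj hi).symm

theorem finset (hμ : IsFinitelyAdditiveProb μ) (s : Finset T) : μ s = ∑ t ∈ s, μ {t} := by
  rw [← hμ.biUnion s (fun t => {t}) fun i j hij => Set.disjoint_singleton.2 hij]
  congr 1
  ext t
  simp

theorem preimage (hμ : IsFinitelyAdditiveProb μ) {C : Type*} [Fintype C] (c : T → C) (B : Set C) :
    μ (c ⁻¹' B) = ∑ b ∈ B.toFinset, μ (c ⁻¹' {b}) := by
  rw [← hμ.biUnion _ _ fun i j hij => Disjoint.preimage c (Set.disjoint_singleton.2 hij)]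
  congr 1
  ext t
  simp

theorem tsum_indicator_singleton_le (hμ : IsFinitelyAdditiveProb μ) (A : Set T) :
    ∑' t, A.indicator (fun t => μ {t}) t ≤ μ A := by
  rw [ENNReal.tsum_eq_iSup_sum]
  refine iSup_le fun s => ?_
  simp only [Set.indicator_apply]
  rw [← Finset.sum_filter, ← hμ.finset]
  exact hμ.mono fun t ht => (Finset.mem_filter.1 ht).2

theorem tsum_indicator_singleton_eq (hμ : IsFinitelyAdditiveProb μ) {A : Set T} (hA : A.Finite) :
    ∑' t, A.indicator (fun t => μ {t}) t = μ A := by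
  obtain ⟨s, rfl⟩ := hA.exists_finset_coe
  rw [hμ.finset, tsum_eq_sum (s := s) fun t ht => Set.indicator_of_notMem (by simpa using ht) _]
  exact Finset.sum_congr rfl fun t ht => Set.indicator_of_mem (by simpa using ht) _

/-- A compactness argument: finitely additive strategies of player 2 which hold every finite set of
rows to `v` have a finitely additive limit holding all rows to `v`. -/
theorem exists_of_forall_finset {π : S → T → Prop} {v : ℝ≥0∞}
    (h : ∀ S₀ : Finset S, ∃ μ : Set T → ℝ≥0∞, IsFinitelyAdditiveProb μ ∧
      ∀ s ∈ S₀, μ {t | π s t} ≤ v) :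
    ∃ μ : Set T → ℝ≥0∞, IsFinitelyAdditiveProb μ ∧ ∀ s, μ {t | π s t} ≤ v := by
  choose m hm hmv using h
  let U : Ultrafilter (Finset S) := Ultrafilter.of Filter.atTop
  have hlim (A : Set T) : ∃ x, Filter.Tendsto (fun S₀ => m S₀ A) U (nhds x) :=
    ⟨_, (U.map fun S₀ => m S₀ A).le_nhds_lim⟩
  choose μ hμ using hlim
  refine ⟨μ, ⟨?_, fun A B hAB => ?_⟩, fun s => ?_⟩
  · refine tendsto_nhds_unique (hμ _) ?_
    simpa only [(hm _).univ] using tendsto_const_nhds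
  · refine tendsto_nhds_unique (hμ _) ?_
    simpa only [(hm _).union A B hAB] using (hμ A).add (hμ B)
  · refine le_of_tendsto (hμ _) ?_
    have : ∀ᶠ S₀ : Finset S in Filter.atTop, s ∈ S₀ :=
      (Filter.eventually_ge_atTop {s}).mono fun S₀ h => h (Finset.mem_singleton_self s)
    exact (this.filter_mono (Ultrafilter.of_le _)).mono fun S₀ => hmv S₀ s

/-- A finitely additive probability can be replaced by a countably additive one without changing the
masses of finitely many fibres, losing mass at a point, or adding much mass to small sets. -/
theorem exists_pmf (hμ : IsFinitelyAdditiveProb μ) {C : Type*} [Finite C] (c : T → C) (k : ℕ)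
    {ε : ℝ≥0∞} (hε : ε ≠ 0) :
    ∃ q : PMF T, (∀ b, q.toOuterMeasure (c ⁻¹' {b}) = μ (c ⁻¹' {b})) ∧ (∀ t, μ {t} ≤ q t) ∧
      ∀ A : Finset T, A.card ≤ k → q.toOuterMeasure A ≤ μ A + ε := by
  have := Fintype.ofFinite C
  have hsum : ∑ b, μ (c ⁻¹' {b}) = 1 := by
    rw [← hμ.univ, ← Set.preimage_univ (f := c), hμ.preimage]
    simp
  obtain ⟨t₀⟩ : Nonempty T := by
    by_contra hT
    rw [not_nonempty_iff] at hT
    simpa [Set.univ_eq_empty_iff.2 hT, hμ.empty] using hμ.univ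
  obtain ⟨N, hN⟩ := ENNReal.exists_inv_nat_lt
    (ENNReal.div_ne_zero.2 ⟨hε, ENNReal.natCast_ne_top (k + 1)⟩)
  have hN0 : N ≠ 0 := by
    rintro rfl
    simp at hN
  have hkN : (k : ℝ≥0∞) * (N : ℝ≥0∞)⁻¹ ≤ ε := by
    calc (k : ℝ≥0∞) * (N : ℝ≥0∞)⁻¹ ≤ ((k + 1 : ℕ) : ℝ≥0∞) * (ε / ((k + 1 : ℕ) : ℝ≥0∞)) := by
          gcongr
          exact k.le_succ
      _ ≤ ε := ENNReal.mul_div_le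
  let d : C → ℝ≥0∞ := fun b =>
    μ (c ⁻¹' {b}) - ∑' t, (c ⁻¹' {b}).indicator (fun t => μ {t}) t
  have hd (b : C) : ∑' t, (c ⁻¹' {b}).indicator (fun t => μ {t}) t + d b = μ (c ⁻¹' {b}) :=
    add_tsub_cancel_of_le (hμ.tsum_indicator_singleton_le _)
  have hν (b : C) : ∃ ν : PMF T, d b ≠ 0 →
      ν.support ⊆ c ⁻¹' {b} ∧ ∀ t, ν t ≤ (N : ℝ≥0∞)⁻¹ := by
    by_cases hb : (c ⁻¹' {b}).Finite
    · exact ⟨PMF.pure t₀, fun h => (h (by simp [d, hμ.tsum_indicator_singleton_eq hb])).elim⟩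
    · obtain ⟨s, hs, rfl⟩ := Set.Infinite.exists_subset_card_eq hb N
      have hne : s.Nonempty := Finset.card_ne_zero.1 hN0
      refine ⟨PMF.uniformOfFinset s hne, fun _ => ⟨by simpa using hs, fun t => ?_⟩⟩
      rw [PMF.uniformOfFinset_apply]
      split_ifs <;> simp
  choose ν hν using hν
  let q : T → ℝ≥0∞ := fun t => μ {t} + ∑ b, d b * ν b t
  have hqfib (b : C) : ∑' t, (c ⁻¹' {b}).indicator q t = μ (c ⁻¹' {b}) := by
    have hsplit (t : T) : (c ⁻¹' {b}).indicator q t =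
        (c ⁻¹' {b}).indicator (fun t => μ {t}) t + d b * ν b t := by
      have hoff (b' : C) (h : c t ≠ b') : d b' * ν b' t = 0 := by
        by_cases h0 : d b' = 0
        · rw [h0, zero_mul]
        · rw [(PMF.apply_eq_zero_iff _ _).2 fun ht => h ((hν b' h0).1 ht), mul_zero]
      by_cases ht : c t = b
      · rw [Set.indicator_of_mem (by simpa using ht), Set.indicator_of_mem (by simpa using ht)]
        refine congrArg (μ {t} + ·) ?_
        exact Finset.sum_eq_single b (fun b' _ hb' => hoff b' (ht.trans_ne hb'.symm))
          fun h => (h (Finset.mem_univ b)).elim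
      · rw [Set.indicator_of_notMem (by simpa using ht), Set.indicator_of_notMem (by simpa using ht),
          hoff b ht, add_zero]
    simp only [hsplit]
    rw [ENNReal.tsum_add, ENNReal.tsum_mul_left, (ν b).tsum_coe, mul_one, hd]
  have hq : ∑' t, q t = 1 := by
    have hpart (t : T) : q t = ∑ b, (c ⁻¹' {b}).indicator q t := by
      rw [Finset.sum_eq_single (c t)] <;> simp +contextual [eq_comm]
    rw [tsum_congr hpart, Summable.tsum_finsetSum fun _ _ => ENNReal.summable]
    simp only [hqfib, hsum]
  let Q : PMF T := ⟨q, hq ▸ ENNReal.summable.hasSum⟩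
  refine ⟨Q, fun b => ?_, fun t => le_self_add, fun A hA => ?_⟩
  · rw [PMF.toOuterMeasure_apply]
    exact hqfib b
  · rw [PMF.toOuterMeasure_apply_finset]
    change ∑ t ∈ A, (μ {t} + ∑ b, d b * ν b t) ≤ _
    rw [Finset.sum_add_distrib, ← hμ.finset, Finset.sum_comm]
    gcongr
    calc ∑ b, ∑ t ∈ A, d b * ν b t ≤ ∑ b, μ (c ⁻¹' {b}) * ε := by
          refine Finset.sum_le_sum fun b _ => ?_
          by_cases h0 : d b = 0
          · simp [h0]
          · rw [← Finset.mul_sum]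
            refine mul_le_mul' tsub_le_self ?_
            calc ∑ t ∈ A, ν b t ≤ A.card • (N : ℝ≥0∞)⁻¹ :=
                  Finset.sum_le_card_nsmul _ _ _ fun t _ => (hν b h0).2 t
              _ ≤ (k : ℝ≥0∞) * (N : ℝ≥0∞)⁻¹ := by rw [nsmul_eq_mul]; gcongr
              _ ≤ ε := hkN
      _ = ε := by rw [← Finset.sum_mul, hsum, one_mul]

end IsFinitelyAdditiveProb

section Counting

variable {S T : Type*} {π : S → T → Prop}

theorem exists_isFinitelyAdditiveProb_le_lowerValue [Nonempty T] (π : S → T → Prop) :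
    ∃ μ : Set T → ℝ≥0∞, IsFinitelyAdditiveProb μ ∧ ∀ s, μ {t | π s t} ≤ lowerValue π :=
  IsFinitelyAdditiveProb.exists_of_forall_finset fun S₀ =>
    let ⟨q, hq⟩ := exists_pmf_rows_le_lowerValue (π := π) S₀
    ⟨_, q.isFinitelyAdditiveProb, hq⟩

/-- A game is minimax if all but finitely many rows have finitely many losing entries or a bounded
number of winning entries for player 1. -/
theorem Minimax.of_rows [Nonempty T] (k : ℕ)
    (h : {s | ¬ ({t | ¬ π s t}.Finite ∨ {t | π s t}.encard ≤ k)}.Finite) : Minimax π := by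
  obtain ⟨μ, hμ, hμv⟩ := exists_isFinitelyAdditiveProb_le_lowerValue π
  refine Minimax.of_forall_exists_le_add fun ε hε => ?_
  set F := {s | ¬ ({t | ¬ π s t}.Finite ∨ {t | π s t}.encard ≤ k)}
  have : Finite F := h
  obtain ⟨q, hfib, hpt, hsmall⟩ := hμ.exists_pmf (fun t (s : F) => π s t) k hε
  refine ⟨q, fun s => ?_⟩
  suffices hs : q.toOuterMeasure {t | π s t} ≤ μ {t | π s t} + ε from
    hs.trans (by gcongr; exact hμv s)
  by_cases hs : s ∈ F
  · have := Fintype.ofFinite F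
    refine le_add_right (le_of_eq ?_)
    change q.toOuterMeasure ((fun t (s : F) => π s t) ⁻¹' {b | b ⟨s, hs⟩}) =
      μ ((fun t (s : F) => π s t) ⁻¹' {b | b ⟨s, hs⟩})
    rw [hμ.preimage, q.isFinitelyAdditiveProb.preimage]
    exact Finset.sum_congr rfl fun b _ => hfib b
  · rcases not_not.1 hs with hfin | hcard
    · refine le_add_right ?_
      have hle : μ {t | ¬ π s t} ≤ q.toOuterMeasure {t | ¬ π s t} := by
        obtain ⟨Z, hZ⟩ := hfin.exists_finset_coe
        rw [← hZ, hμ.finset, PMF.toOuterMeasure_apply_finset]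
        exact Finset.sum_le_sum fun t _ => hpt t
      have hne : μ {t | ¬ π s t} ≠ ⊤ := ne_top_of_le_ne_top ENNReal.one_ne_top (hμ.le_one _)
      refine (ENNReal.add_le_add_iff_right hne).1 ?_
      calc _ ≤ q.toOuterMeasure {t | π s t} + q.toOuterMeasure {t | ¬ π s t} := by gcongr
        _ = μ {t | π s t} + μ {t | ¬ π s t} :=
          (q.isFinitelyAdditiveProb.add_compl _).trans (hμ.add_compl _).symm
    · obtain ⟨Z, hZ⟩ := (Set.finite_of_encard_le_coe hcard).exists_finset_coe
      rw [← hZ] at hcard ⊢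
      exact hsmall Z (by simpa using hcard)

theorem encard_subtype_setOf_le (T' : Set T) (P : T → Prop) :
    {t : T' | P t}.encard ≤ {t | P t}.encard := by
  rw [← Subtype.val_injective.encard_image]
  exact Set.encard_le_encard (by rintro _ ⟨t, ht, rfl⟩; exact ht)

theorem Set.Finite.subtype_setOf {P : T → Prop} (h : {t | P t}.Finite) (T' : Set T) :
    {t : T' | P t}.Finite :=
  h.preimage Subtype.val_injective.injOn

/-- The row condition of `Minimax.of_rows` passes to subgames. -/
theorem TotallyMinimax.of_rows (k : ℕ)
    (h : {s | ¬ ({t | ¬ π s t}.Finite ∨ {t | π s t}.encard ≤ k)}.Finite) :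
    TotallyMinimax π := by
  intro S' T' _ hT'
  have := hT'.to_subtype
  refine Minimax.of_rows k ((h.subtype_setOf S').subset fun s hs hs' => hs ?_)
  exact hs'.imp (fun h => h.subtype_setOf T') (encard_subtype_setOf_le T' _).trans

theorem TotallyMinimax.of_dual (h : TotallyMinimax fun t s => ¬ π s t) : TotallyMinimax π := by
  intro S' T' hS' hT'
  have := hS'.to_subtype
  have := hT'.to_subtype
  exact Minimax.of_dual (h T' S' hT' hS')

end Counting

/-- Corollary 3.2: a game is totally minimax whenever one of the following holds:
(1) all but finitely many rows have finitely many `0` entries;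
(2) all but finitely many rows have at most `k` entries `1`, for some finite `k`;
(3) all but finitely many columns have at most `k` entries `0`, for some finite `k`;
(4) all but finitely many columns have finitely many `1` entries. -/
theorem totallyMinimax_of_counting_conditions
    {S T : Type*} [Nonempty S] [Nonempty T] (π : S → T → Prop)
    (h : {s : S | ¬ ({t : T | ¬ π s t}.Finite)}.Finite ∨
         (∃ k : ℕ, {s : S | ¬ ({t : T | π s t}.encard ≤ (k : ℕ∞))}.Finite) ∨
         (∃ k : ℕ, {t : T | ¬ ({s : S | ¬ π s t}.encard ≤ (k : ℕ∞))}.Finite) ∨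
         {t : T | ¬ ({s : S | π s t}.Finite)}.Finite) :
    TotallyMinimax π := by
  rcases h with h | ⟨k, h⟩ | ⟨k, h⟩ | h
  · exact .of_rows 0 (h.subset fun s hs h0 => hs (.inl h0))
  · exact .of_rows k (h.subset fun s hs h1 => hs (.inr h1))
  · exact .of_dual (.of_rows k (h.subset fun t ht h0 => ht (.inr h0)))
  · exact .of_dual (.of_rows 0 (h.subset fun t ht h1 => ht (.inl (by simpa using h1))))
end
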